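/- arXiv:1211.7325 — 2 statements merged into one kernel-verified Lean document; each statement's English description precedes it below -/
import Mathlib

section
/- For all real ν ≥ 0, every natural number n ≥ 1, and all x > 0, the repeated integrals satisfy I_{(ν,0,n)}(x) < (∏_{k=1}^n (2ν+2k)/(2ν+k)) x^ν I_{ν+n}(x). -/
open Real MeasureTheory

/-- The modified Bessel function of the first kind
`I_ν(x) = Σ_{k=0}^∞ (1/(k! Γ(k+ν+1))) (x/2)^{2k+ν}`. -/
noncomputable def besselI (ν x : ℝ) : ℝ :=
  ∑' k : ℕ, (1 / ((k.factorial : ℝ) * Real.Gamma ((k : ℝ) + ν + 1))) *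
    (x / 2) ^ (2 * (k : ℝ) + ν)

/-- The repeated integrals `I_{(ν,β,0)}(x) = e^{βx} x^ν I_ν(x)`,
`I_{(ν,β,n+1)}(x) = ∫_0^x I_{(ν,β,n)}(y) dy`. -/
noncomputable def besselIRep (ν β : ℝ) : ℕ → ℝ → ℝ
  | 0 => fun x => Real.exp (β * x) * x ^ ν * besselI ν x
  | n + 1 => fun x => ∫ y in (0 : ℝ)..x, besselIRep ν β n y

/-- The coefficient of `x ^ (2k + 2ν)` in the expansion of `x ^ ν * besselI ν x`. -/
noncomputable def besselICoeff (ν : ℝ) (k : ℕ) : ℝ :=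
  1 / ((k.factorial : ℝ) * Real.Gamma ((k : ℝ) + ν + 1) * 2 ^ (2 * (k : ℝ) + ν))

lemma besselICoeff_pos {ν : ℝ} (hν : 0 ≤ ν) (k : ℕ) : 0 < besselICoeff ν k := by
  have : 0 < Real.Gamma ((k : ℝ) + ν + 1) := Real.Gamma_pos_of_pos (by positivity)
  unfold besselICoeff
  positivity

lemma Gamma_add_one_le_Gamma_nat_add {ν : ℝ} (hν : 0 ≤ ν) (k : ℕ) :
    Real.Gamma (ν + 1) ≤ Real.Gamma ((k : ℝ) + ν + 1) := by
  induction k with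
  | zero => simp
  | succ k ih =>
    have hpos : 0 < Real.Gamma ((k : ℝ) + ν + 1) := Real.Gamma_pos_of_pos (by positivity)
    have hk : (0 : ℝ) ≤ k := k.cast_nonneg
    rw [show ((k + 1 : ℕ) : ℝ) + ν + 1 = ((k : ℝ) + ν + 1) + 1 by push_cast; ring,
      Real.Gamma_add_one (s := (k : ℝ) + ν + 1) (by positivity)]
    nlinarith [mul_nonneg (add_nonneg hk hν) hpos.le]

lemma summable_besselI {ν : ℝ} (hν : 0 ≤ ν) {x : ℝ} (hx : 0 < x) :
    Summable fun k : ℕ => (1 / ((k.factorial : ℝ) * Real.Gamma ((k : ℝ) + ν + 1))) *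
      (x / 2) ^ (2 * (k : ℝ) + ν) := by
  have hG : 0 < Real.Gamma (ν + 1) := Real.Gamma_pos_of_pos (by positivity)
  refine Summable.of_nonneg_of_le (fun k => ?_) (fun k => ?_)
    ((Real.summable_pow_div_factorial ((x / 2) ^ 2)).mul_left ((x / 2) ^ ν / Real.Gamma (ν + 1)))
  · have : 0 < Real.Gamma ((k : ℝ) + ν + 1) := Real.Gamma_pos_of_pos (by positivity)
    positivity
  · have hpow : (x / 2) ^ (2 * (k : ℝ) + ν) = ((x / 2) ^ 2) ^ k * (x / 2) ^ ν := by
      rw [Real.rpow_add (by positivity), ← pow_mul, ← Real.rpow_natCast (x / 2) (2 * k)]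
      push_cast
      rfl
    calc (1 / ((k.factorial : ℝ) * Real.Gamma ((k : ℝ) + ν + 1))) * (x / 2) ^ (2 * (k : ℝ) + ν)
        ≤ (1 / ((k.factorial : ℝ) * Real.Gamma (ν + 1))) * (x / 2) ^ (2 * (k : ℝ) + ν) := by
          gcongr
          exact Gamma_add_one_le_Gamma_nat_add hν k
      _ = _ := by
          rw [hpow]
          field_simp

lemma Gamma_add_nat_add_one {s : ℝ} (hs : 0 ≤ s) (n : ℕ) :
    Real.Gamma (s + n + 1) = (∏ j ∈ Finset.Icc 1 n, (s + (j : ℝ))) * Real.Gamma (s + 1) := by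
  induction n with
  | zero => simp
  | succ n ih =>
    rw [Finset.prod_Icc_succ_top (by omega), Real.Gamma_add_one (by positivity)]
    push_cast
    rw [← add_assoc, ih]
    ring

lemma hasSum_rpow_mul_besselI_add {ν : ℝ} (hν : 0 ≤ ν) (n : ℕ) {x : ℝ} (hx : 0 < x) :
    HasSum (fun k : ℕ => besselICoeff ν k /
        (∏ j ∈ Finset.Icc 1 n, (2 * ((k : ℝ) + ν) + 2 * (j : ℝ))) * x ^ (2 * (k : ℝ) + 2 * ν + n))
      (x ^ ν * besselI (ν + n) x) := by
  refine ((summable_besselI (ν := ν + n) (by positivity) hx).hasSum.mul_left (x ^ ν)).congr_fun ?_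
  intro k
  have hG : Real.Gamma ((k : ℝ) + (ν + n) + 1) =
      (∏ j ∈ Finset.Icc 1 n, ((k : ℝ) + ν + (j : ℝ))) * Real.Gamma ((k : ℝ) + ν + 1) := by
    rw [← add_assoc, Gamma_add_nat_add_one (by positivity)]
  have hprod : ∏ j ∈ Finset.Icc 1 n, (2 * ((k : ℝ) + ν) + 2 * (j : ℝ)) =
      2 ^ n * ∏ j ∈ Finset.Icc 1 n, ((k : ℝ) + ν + (j : ℝ)) := by
    simp only [← mul_add, Finset.prod_mul_distrib, Finset.prod_const, Nat.card_Icc,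
      Nat.add_sub_cancel]
  have hpos : 0 < ∏ j ∈ Finset.Icc 1 n, ((k : ℝ) + ν + (j : ℝ)) :=
    Finset.prod_pos fun j hj => by
      have : (0 : ℝ) < j := by exact_mod_cast (Finset.mem_Icc.mp hj).1
      positivity
  have hGpos : 0 < Real.Gamma ((k : ℝ) + ν + 1) := Real.Gamma_pos_of_pos (by positivity)
  have h2 : (2 : ℝ) ^ (2 * (k : ℝ) + (ν + n)) = 2 ^ (2 * (k : ℝ) + ν) * 2 ^ n := by
    rw [← add_assoc, Real.rpow_add two_pos, Real.rpow_natCast]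
  have hxpow : x ^ (2 * (k : ℝ) + 2 * ν + n) = x ^ ν * x ^ (2 * (k : ℝ) + (ν + n)) := by
    rw [← Real.rpow_add hx]
    ring_nf
  rw [hG, hprod, Real.div_rpow hx.le two_pos.le, h2, hxpow, besselICoeff]
  field_simp

lemma prod_two_mul_add_pos {s : ℝ} (hs : 0 ≤ s) (n : ℕ) :
    0 < ∏ j ∈ Finset.Icc 1 n, (2 * s + (j : ℝ)) :=
  Finset.prod_pos fun j hj => by
    have : (0 : ℝ) < j := by exact_mod_cast (Finset.mem_Icc.mp hj).1
    positivity

lemma prod_two_mul_add_two_mul_pos {s : ℝ} (hs : 0 ≤ s) (n : ℕ) :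
    0 < ∏ j ∈ Finset.Icc 1 n, (2 * s + 2 * (j : ℝ)) :=
  Finset.prod_pos fun j hj => by
    have : (0 : ℝ) < j := by exact_mod_cast (Finset.mem_Icc.mp hj).1
    positivity

lemma summable_besselIRep_zero {ν : ℝ} (hν : 0 ≤ ν) (n : ℕ) {x : ℝ} (hx : 0 < x) :
    Summable fun k : ℕ => besselICoeff ν k /
      (∏ j ∈ Finset.Icc 1 n, (2 * ((k : ℝ) + ν) + (j : ℝ))) * x ^ (2 * (k : ℝ) + 2 * ν + n) := by
  have h0 := (hasSum_rpow_mul_besselI_add hν 0 hx).summable.mul_right (x ^ n)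
  refine Summable.of_nonneg_of_le (fun k => ?_) (fun k => ?_) h0
  · have := besselICoeff_pos hν k
    have := prod_two_mul_add_pos (s := (k : ℝ) + ν) (by positivity) n
    positivity
  · have hC := besselICoeff_pos hν k
    have hone : 1 ≤ ∏ j ∈ Finset.Icc 1 n, (2 * ((k : ℝ) + ν) + (j : ℝ)) :=
      Finset.prod_induction _ (1 ≤ ·) (fun _ _ => one_le_mul_of_one_le_of_one_le) le_rfl
        fun j hj => by
        have : (1 : ℝ) ≤ j := by exact_mod_cast (Finset.mem_Icc.mp hj).1
        have : (0 : ℝ) ≤ k := k.cast_nonneg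
        linarith
    rw [Real.rpow_add hx _ (n : ℝ), Real.rpow_natCast, ← mul_assoc]
    simp only [Finset.Icc_eq_empty_of_lt Nat.zero_lt_one, Finset.prod_empty, Nat.cast_zero,
      add_zero, div_one]
    gcongr
    exact div_le_self hC.le hone

lemma hasSum_besselIRep_zero {ν : ℝ} (hν : 0 ≤ ν) (n : ℕ) {x : ℝ} (hx : 0 < x) :
    HasSum (fun k : ℕ => besselICoeff ν k /
        (∏ j ∈ Finset.Icc 1 n, (2 * ((k : ℝ) + ν) + (j : ℝ))) * x ^ (2 * (k : ℝ) + 2 * ν + n))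
      (besselIRep ν 0 n x) := by
  induction n generalizing x with
  | zero => simpa [besselIRep] using hasSum_rpow_mul_besselI_add hν 0 hx
  | succ n ih =>
    have hexp : ∀ k : ℕ, 0 ≤ 2 * (k : ℝ) + 2 * ν + n := fun k => by positivity
    have hint : ∀ k : ℕ, (∫ y in Set.Ioc 0 x, besselICoeff ν k /
          (∏ j ∈ Finset.Icc 1 n, (2 * ((k : ℝ) + ν) + (j : ℝ))) * y ^ (2 * (k : ℝ) + 2 * ν + n)) =
        besselICoeff ν k / (∏ j ∈ Finset.Icc 1 (n + 1), (2 * ((k : ℝ) + ν) + (j : ℝ))) *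
          x ^ (2 * (k : ℝ) + 2 * ν + (n + 1 : ℕ)) := by
      intro k
      have hk := hexp k
      have hp := prod_two_mul_add_pos (s := (k : ℝ) + ν) (by positivity) n
      rw [← intervalIntegral.integral_of_le hx.le, intervalIntegral.integral_const_mul,
        integral_rpow (Or.inl (by linarith)), Real.zero_rpow (by positivity),
        Finset.prod_Icc_succ_top (by omega)]
      push_cast
      rw [show 2 * ((k : ℝ) + ν) + ((n : ℝ) + 1) = 2 * (k : ℝ) + 2 * ν + n + 1 by ring,
        ← add_assoc, sub_zero]
      field_simp
    have hnorm : ∀ k : ℕ, (∫ y in Set.Ioc 0 x, ‖besselICoeff ν k /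
          (∏ j ∈ Finset.Icc 1 n, (2 * ((k : ℝ) + ν) + (j : ℝ))) *
            y ^ (2 * (k : ℝ) + 2 * ν + n)‖) =
        besselICoeff ν k / (∏ j ∈ Finset.Icc 1 (n + 1), (2 * ((k : ℝ) + ν) + (j : ℝ))) *
          x ^ (2 * (k : ℝ) + 2 * ν + (n + 1 : ℕ)) := by
      intro k
      rw [← hint k]
      refine setIntegral_congr_fun measurableSet_Ioc fun y hy => ?_
      have hy0 := hy.1
      have := besselICoeff_pos hν k
      have := prod_two_mul_add_pos (s := (k : ℝ) + ν) (by positivity) n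
      exact Real.norm_of_nonneg (by positivity)
    have hsum := hasSum_integral_of_summable_integral_norm (μ := volume.restrict (Set.Ioc 0 x))
      (F := fun (k : ℕ) (y : ℝ) => besselICoeff ν k /
        (∏ j ∈ Finset.Icc 1 n, (2 * ((k : ℝ) + ν) + (j : ℝ))) * y ^ (2 * (k : ℝ) + 2 * ν + n))
      (fun k => ((intervalIntegral.intervalIntegrable_rpow' (by linarith [hexp k])).1.const_mul _))
      (by simpa only [hnorm] using summable_besselIRep_zero hν (n + 1) hx)
    simp only [hint] at hsum
    have hrep : besselIRep ν 0 (n + 1) x = ∫ y in Set.Ioc 0 x, ∑' k : ℕ, besselICoeff ν k /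
        (∏ j ∈ Finset.Icc 1 n, (2 * ((k : ℝ) + ν) + (j : ℝ))) *
          y ^ (2 * (k : ℝ) + 2 * ν + n) := by
      simp only [besselIRep]
      rw [intervalIntegral.integral_of_le hx.le]
      exact setIntegral_congr_fun measurableSet_Ioc fun y hy => (ih hy.1).tsum_eq.symm
    rw [hrep]
    exact hsum

lemma div_two_mul_add_lt {s t j : ℝ} (hs : 0 ≤ s) (hst : s < t) (hj : 0 < j) :
    (2 * t + 2 * j) / (2 * t + j) < (2 * s + 2 * j) / (2 * s + j) := by
  rw [div_lt_div_iff₀ (by linarith) (by linarith)]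
  nlinarith

lemma prod_div_two_mul_add_lt {s t : ℝ} (hs : 0 ≤ s) (hst : s < t) {n : ℕ} (hn : 1 ≤ n) :
    ∏ j ∈ Finset.Icc 1 n, (2 * t + 2 * (j : ℝ)) / (2 * t + (j : ℝ)) <
      ∏ j ∈ Finset.Icc 1 n, (2 * s + 2 * (j : ℝ)) / (2 * s + (j : ℝ)) := by
  have ht : 0 < t := hs.trans_lt hst
  refine Finset.prod_lt_prod_of_nonempty (fun j _ => by positivity) (fun j hj => ?_)
    (Finset.nonempty_Icc.mpr hn)
  exact div_two_mul_add_lt hs hst (by exact_mod_cast (Finset.mem_Icc.mp hj).1)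

theorem besselIRep_upper_bound (ν : ℝ) (hν : 0 ≤ ν) (n : ℕ) (hn : 1 ≤ n) (x : ℝ) (hx : 0 < x) :
    besselIRep ν 0 n x <
      (∏ k ∈ Finset.Icc 1 n, (2 * ν + 2 * (k : ℝ)) / (2 * ν + (k : ℝ))) *
        x ^ ν * besselI (ν + n) x := by
  rw [mul_assoc]
  have hterm : ∀ k : ℕ, besselICoeff ν k /
      (∏ j ∈ Finset.Icc 1 n, (2 * ((k : ℝ) + ν) + (j : ℝ))) * x ^ (2 * (k : ℝ) + 2 * ν + n) =
      (∏ j ∈ Finset.Icc 1 n, (2 * ((k : ℝ) + ν) + 2 * (j : ℝ)) / (2 * ((k : ℝ) + ν) + (j : ℝ))) *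
      (besselICoeff ν k / (∏ j ∈ Finset.Icc 1 n, (2 * ((k : ℝ) + ν) + 2 * (j : ℝ))) *
        x ^ (2 * (k : ℝ) + 2 * ν + n)) := by
    intro k
    have h2 := prod_two_mul_add_two_mul_pos (s := (k : ℝ) + ν) (by positivity) n
    rw [Finset.prod_div_distrib, ← mul_assoc, div_mul_div_comm,
      mul_comm (∏ j ∈ Finset.Icc 1 n, (2 * ((k : ℝ) + ν) + (j : ℝ))),
      mul_div_mul_left _ _ h2.ne']
  have hpos : ∀ k : ℕ, 0 < besselICoeff ν k /
      (∏ j ∈ Finset.Icc 1 n, (2 * ((k : ℝ) + ν) + 2 * (j : ℝ))) *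
        x ^ (2 * (k : ℝ) + 2 * ν + n) := by
    intro k
    have h1 := besselICoeff_pos hν k
    have h2 := prod_two_mul_add_two_mul_pos (s := (k : ℝ) + ν) (by positivity) n
    positivity
  have hlt : ∀ k : ℕ, 1 ≤ k → ν < (k : ℝ) + ν := fun k hk => by
    have : (1 : ℝ) ≤ k := by exact_mod_cast hk
    linarith
  refine hasSum_lt (i := 1) (fun k => ?_) ?_ (hasSum_besselIRep_zero hν n hx)
    ((hasSum_rpow_mul_besselI_add hν n hx).mul_left _)
  · rw [hterm]
    refine mul_le_mul_of_nonneg_right ?_ (hpos k).le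
    rcases Nat.eq_zero_or_pos k with rfl | hk
    · simp
    · exact (prod_div_two_mul_add_lt hν (hlt k hk) hn).le
  · rw [hterm]
    exact mul_lt_mul_of_pos_right (prod_div_two_mul_add_lt hν (hlt 1 le_rfl) hn) (hpos 1)
end

section
/- For all real ν ≥ 1/2, all real γ with 0 ≤ γ < 1, every natural number n ≥ 1, and all x > 0, the repeated integrals satisfy I_{(ν,-γ,n)}(x) < (1-γ)^{-n} (∏_{k=1}^n (2ν+2k)/(2ν+k)) e^{-γx} x^ν I_{ν+n}(x). -/
open Real MeasureTheory

/-- The entire function `g_μ` with `I_μ(x) = (x/2)^μ g_μ(x²/4)`. -/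
noncomputable def besselAux (μ t : ℝ) : ℝ :=
  ∑' k : ℕ, t ^ k / ((k.factorial : ℝ) * Real.Gamma ((k : ℝ) + μ + 1))

theorem Gamma_le_Gamma_natCast_add {μ : ℝ} (hμ : 0 ≤ μ) (k : ℕ) :
    Real.Gamma (μ + 1) ≤ Real.Gamma ((k : ℝ) + μ + 1) := by
  induction k with
  | zero => simp
  | succ k ih =>
    have hk : (0 : ℝ) ≤ k := k.cast_nonneg
    have h1 : ((k + 1 : ℕ) : ℝ) + μ + 1 = ((k : ℝ) + μ + 1) + 1 := by push_cast; ring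
    have h2 : 0 < (k : ℝ) + μ + 1 := by positivity
    rw [h1, Real.Gamma_add_one h2.ne']
    exact ih.trans (le_mul_of_one_le_left (Real.Gamma_pos_of_pos h2).le (by linarith))

theorem summable_besselAux {μ : ℝ} (hμ : 0 ≤ μ) (t : ℝ) :
    Summable fun k : ℕ => t ^ k / ((k.factorial : ℝ) * Real.Gamma ((k : ℝ) + μ + 1)) := by
  have hG : 0 < Real.Gamma (μ + 1) := Real.Gamma_pos_of_pos (by positivity)
  refine Summable.of_norm_bounded
    (g := fun k : ℕ => |t| ^ k / (k.factorial : ℝ) * (1 / Real.Gamma (μ + 1)))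
    ((Real.summable_pow_div_factorial |t|).mul_right _) fun k => ?_
  have hk := Gamma_le_Gamma_natCast_add hμ k
  have hf : (0 : ℝ) < k.factorial := by positivity
  rw [Real.norm_eq_abs, abs_div, abs_pow, abs_of_pos (mul_pos hf (hG.trans_le hk)), div_mul_div_comm,
    mul_one]
  gcongr

theorem hasDerivAt_besselAux {μ : ℝ} (hμ : 0 ≤ μ) (t : ℝ) :
    HasDerivAt (besselAux μ) (besselAux (μ + 1) t) t := by
  have hG : 0 < Real.Gamma (μ + 1) := Real.Gamma_pos_of_pos (by positivity)
  have hterm : ∀ (k : ℕ) (y : ℝ),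
      ((k + 1 : ℕ) : ℝ) * y ^ k /
        (((k + 1).factorial : ℝ) * Real.Gamma (((k + 1 : ℕ) : ℝ) + μ + 1)) =
      y ^ k / ((k.factorial : ℝ) * Real.Gamma ((k : ℝ) + (μ + 1) + 1)) := by
    intro k y
    have h1 : ((k + 1 : ℕ) : ℝ) + μ + 1 = (k : ℝ) + (μ + 1) + 1 := by push_cast; ring
    have h2 : ((k + 1 : ℕ) : ℝ) ≠ 0 := by positivity
    rw [h1, Nat.factorial_succ, Nat.cast_mul, mul_assoc, mul_div_mul_left _ _ h2]
  have hsum (R : ℝ) : Summable fun k : ℕ =>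
      (k : ℝ) * R ^ (k - 1) / ((k.factorial : ℝ) * Real.Gamma ((k : ℝ) + μ + 1)) := by
    rw [← summable_nat_add_iff 1]
    refine (summable_besselAux (add_nonneg hμ zero_le_one) R).congr fun k => ?_
    rw [Nat.add_sub_cancel]
    exact (hterm k R).symm
  have key := hasDerivAt_tsum_of_isPreconnected (t := Metric.ball (0 : ℝ) (|t| + 1))
    (g := fun (k : ℕ) y => y ^ k / ((k.factorial : ℝ) * Real.Gamma ((k : ℝ) + μ + 1)))
    (g' := fun (k : ℕ) y =>
      (k : ℝ) * y ^ (k - 1) / ((k.factorial : ℝ) * Real.Gamma ((k : ℝ) + μ + 1)))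
    (hsum (|t| + 1)) Metric.isOpen_ball (convex_ball _ _).isPreconnected
    (fun k y _ => (hasDerivAt_pow k y).div_const _)
    (fun k y hy => by
      have hk := hG.trans_le (Gamma_le_Gamma_natCast_add hμ k)
      have hy' : |y| ≤ |t| + 1 := by simpa using (mem_ball_zero_iff.1 hy).le
      rw [Real.norm_eq_abs, abs_div, abs_mul, abs_pow, Nat.abs_cast,
        abs_of_pos (mul_pos (by positivity : (0 : ℝ) < k.factorial) hk)]
      gcongr)
    (y₀ := t) (by simp) (summable_besselAux hμ t) (y := t) (by simp)
  refine key.congr_deriv (Eq.symm ?_)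
  unfold besselAux
  rw [(hsum t).tsum_eq_zero_add]
  simp only [Nat.cast_zero, zero_mul, zero_div, zero_add, Nat.add_sub_cancel]
  exact tsum_congr fun k => (hterm k t).symm

theorem besselAux_recurrence {μ : ℝ} (hμ : 0 ≤ μ) (t : ℝ) :
    besselAux μ t = t * besselAux (μ + 2) t + (μ + 1) * besselAux (μ + 1) t := by
  have hs2 := (summable_besselAux (add_nonneg hμ zero_le_two) t).mul_left t
  have hs1 := summable_besselAux (add_nonneg hμ zero_le_one) t
  have hterm : ∀ k : ℕ,
      t ^ k / ((k.factorial : ℝ) * Real.Gamma ((k : ℝ) + μ + 1)) =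
        (k : ℝ) * (t ^ k / ((k.factorial : ℝ) * Real.Gamma ((k : ℝ) + (μ + 1) + 1))) +
        (μ + 1) * (t ^ k / ((k.factorial : ℝ) * Real.Gamma ((k : ℝ) + (μ + 1) + 1))) := by
    intro k
    have h0 : (k : ℝ) + μ + 1 ≠ 0 := by positivity
    have hG : Real.Gamma ((k : ℝ) + μ + 1) ≠ 0 := (Real.Gamma_pos_of_pos (by positivity)).ne'
    rw [show (k : ℝ) + (μ + 1) + 1 = ((k : ℝ) + μ + 1) + 1 by ring, Real.Gamma_add_one h0]
    field_simp
    ring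
  have hshift : ∀ k : ℕ,
      ((k + 1 : ℕ) : ℝ) * (t ^ (k + 1) /
        (((k + 1).factorial : ℝ) * Real.Gamma (((k + 1 : ℕ) : ℝ) + (μ + 1) + 1))) =
      t * (t ^ k / ((k.factorial : ℝ) * Real.Gamma ((k : ℝ) + (μ + 2) + 1))) := by
    intro k
    have hG : Real.Gamma ((k : ℝ) + (μ + 2) + 1) ≠ 0 :=
      (Real.Gamma_pos_of_pos (by positivity)).ne'
    rw [show ((k + 1 : ℕ) : ℝ) + (μ + 1) + 1 = (k : ℝ) + (μ + 2) + 1 by push_cast; ring,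
      Nat.factorial_succ, Nat.cast_mul, pow_succ]
    field_simp
  have hs0 : Summable fun k : ℕ =>
      (k : ℝ) * (t ^ k / ((k.factorial : ℝ) * Real.Gamma ((k : ℝ) + (μ + 1) + 1))) := by
    rw [← summable_nat_add_iff 1]
    exact hs2.congr fun k => (hshift k).symm
  unfold besselAux
  rw [tsum_congr hterm, hs0.tsum_add (hs1.mul_left _), tsum_mul_left, hs0.tsum_eq_zero_add,
    tsum_congr hshift, tsum_mul_left]
  simp

theorem besselAux_pos {μ t : ℝ} (hμ : 0 ≤ μ) (ht : 0 ≤ t) : 0 < besselAux μ t := by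
  have hG : ∀ k : ℕ, 0 < Real.Gamma ((k : ℝ) + μ + 1) := fun k =>
    Real.Gamma_pos_of_pos (by positivity)
  refine (summable_besselAux hμ t).tsum_pos (fun k => ?_) 0 ?_
  · have := hG k
    positivity
  · have := hG 0
    simpa using this

/-- `h_μ(x) = g_μ(x²/4)`, so that `I_μ(x) = (x/2)^μ h_μ(x)`. -/
noncomputable def besselEven (μ x : ℝ) : ℝ := besselAux μ (x ^ 2 / 4)

theorem besselEven_pos {μ : ℝ} (hμ : 0 ≤ μ) (x : ℝ) : 0 < besselEven μ x :=
  besselAux_pos hμ (by positivity)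

theorem hasDerivAt_besselEven {μ : ℝ} (hμ : 0 ≤ μ) (x : ℝ) :
    HasDerivAt (besselEven μ) (x / 2 * besselEven (μ + 1) x) x := by
  have h := (hasDerivAt_besselAux hμ (x ^ 2 / 4)).comp x ((hasDerivAt_pow 2 x).div_const 4)
  refine h.congr_deriv ?_
  unfold besselEven
  push_cast
  ring

theorem continuous_besselEven {μ : ℝ} (hμ : 0 ≤ μ) : Continuous (besselEven μ) :=
  continuous_iff_continuousAt.2 fun x => (hasDerivAt_besselEven hμ x).continuousAt

theorem besselEven_recurrence {μ : ℝ} (hμ : 0 ≤ μ) (x : ℝ) :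
    besselEven μ x =
      x ^ 2 / 4 * besselEven (μ + 2) x + (μ + 1) * besselEven (μ + 1) x :=
  besselAux_recurrence hμ _

theorem besselI_eq_besselEven {μ x : ℝ} (hμ : 0 < μ) (hx : 0 ≤ x) :
    besselI μ x = (x / 2) ^ μ * besselEven μ x := by
  unfold besselI besselEven besselAux
  rw [← tsum_mul_left]
  refine tsum_congr fun k => ?_
  have hx2 : 0 ≤ x / 2 := by positivity
  rw [Real.rpow_add_of_nonneg hx2 (by positivity) hμ.le, Real.rpow_mul hx2,
    Real.rpow_natCast, Real.rpow_two, div_pow, show (2 : ℝ) ^ 2 = 4 by norm_num]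
  ring

theorem nonneg_of_hasDerivAt_nonneg {f f' : ℝ → ℝ} (hf : ContinuousOn f (Set.Ici 0))
    (hd : ∀ x, 0 < x → HasDerivAt f (f' x) x) (hf' : ∀ x, 0 < x → 0 ≤ f' x) (h0 : 0 ≤ f 0)
    {x : ℝ} (hx : 0 ≤ x) : 0 ≤ f x := by
  refine h0.trans (monotoneOn_of_deriv_nonneg (convex_Ici 0) hf ?_ ?_ Set.self_mem_Ici hx hx)
  · rw [interior_Ici]
    exact fun y hy => (hd y hy).differentiableAt.differentiableWithinAt
  · rw [interior_Ici]
    intro y hy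
    rw [(hd y hy).deriv]
    exact hf' y hy

theorem pos_of_hasDerivAt_pos {f f' : ℝ → ℝ} (hf : ContinuousOn f (Set.Ici 0))
    (hd : ∀ x, 0 < x → HasDerivAt f (f' x) x) (hf' : ∀ x, 0 < x → 0 < f' x) (h0 : 0 ≤ f 0)
    {x : ℝ} (hx : 0 < x) : 0 < f x := by
  refine h0.trans_lt (strictMonoOn_of_deriv_pos (convex_Ici 0) hf ?_ Set.self_mem_Ici hx.le hx)
  rw [interior_Ici]
  intro y hy
  rw [(hd y hy).deriv]
  exact hf' y hy

/-- The inequality `u' ≥ u` for `u(x) = √x I_μ(x)`, written in terms of `h_μ`. -/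
theorem mul_besselEven_le {μ x : ℝ} (hμ : 1 / 2 ≤ μ) (hx : 0 < x) :
    x * besselEven μ x ≤
      (μ + 1 / 2) * besselEven μ x + x * (x / 2 * besselEven (μ + 1) x) := by
  have hμ0 : 0 ≤ μ := by linarith
  have hμ1 : 0 ≤ μ + 1 := by linarith
  set W : ℝ → ℝ := fun y =>
    (μ + 1 / 2) * besselEven μ y + y * (y / 2 * besselEven (μ + 1) y) - y * besselEven μ y with hW
  have c0 := continuous_besselEven hμ0
  have c1 := continuous_besselEven hμ1
  have hdW : ∀ y, HasDerivAt W
      ((μ + 1 / 2) * (y / 2 * besselEven (μ + 1) y) +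
        (1 * (y / 2 * besselEven (μ + 1) y) + y * (1 / 2 * besselEven (μ + 1) y +
          y / 2 * (y / 2 * besselEven (μ + 1 + 1) y))) -
        (1 * besselEven μ y + y * (y / 2 * besselEven (μ + 1) y))) y := fun y =>
    (((hasDerivAt_besselEven hμ0 y).const_mul _).add ((hasDerivAt_id y).mul
      (((hasDerivAt_id y).div_const 2).mul (hasDerivAt_besselEven hμ1 y)))).sub
      ((hasDerivAt_id y).mul (hasDerivAt_besselEven hμ0 y))
  have key : 0 ≤ Real.exp x * x ^ (μ - 1 / 2) * W x := by
    refine nonneg_of_hasDerivAt_nonneg (f := fun y => Real.exp y * y ^ (μ - 1 / 2) * W y)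
      (f' := fun y => Real.exp y * y ^ (μ - 1 / 2 - 1) *
        ((μ + 1 / 2) * (μ - 1 / 2) * besselEven μ y)) ?_ ?_ ?_ ?_ hx.le
    · refine Continuous.continuousOn ((Real.continuous_exp.mul
        (Real.continuous_rpow_const (by linarith))).mul ?_)
      rw [hW]
      fun_prop
    · intro y hy
      refine (((Real.hasDerivAt_exp y).mul (Real.hasDerivAt_rpow_const (p := μ - 1 / 2)
        (Or.inl hy.ne'))).mul (hdW y)).congr_deriv ?_
      have hr : y ^ (μ - 1 / 2) = y ^ (μ - 1 / 2 - 1) * y := by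
        rw [← Real.rpow_add_one hy.ne']
        congr 1
        ring
      have hrec := besselEven_recurrence hμ0 y
      rw [show μ + 2 = μ + 1 + 1 by ring] at hrec
      simp only [hW, Pi.mul_apply, hr]
      linear_combination (-Real.exp y * y ^ (μ - 1 / 2 - 1) * y ^ 2) * hrec
    · intro y hy
      have := besselEven_pos hμ0 y
      have h1 : 0 ≤ μ - 1 / 2 := by linarith
      positivity
    · have := besselEven_pos hμ0 0
      have h1 : (0 : ℝ) ≤ 0 ^ (μ - 1 / 2) := Real.rpow_nonneg le_rfl _
      simp only [hW]
      simp only [zero_mul, add_zero, sub_zero]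
      positivity
  have hpos : 0 < Real.exp x * x ^ (μ - 1 / 2) := by positivity
  have := nonneg_of_mul_nonneg_right key hpos
  simp only [hW] at this
  linarith

theorem exists_primitive_of_continuousOn {f : ℝ → ℝ} (hf : ContinuousOn f (Set.Ici 0)) :
    ContinuousOn (fun x => ∫ y in (0 : ℝ)..x, f y) (Set.Ici 0) ∧
      ∀ x, 0 < x → HasDerivAt (fun x => ∫ y in (0 : ℝ)..x, f y) (f x) x := by
  have hc : Continuous fun y => f (max y 0) :=
    hf.comp_continuous (by fun_prop) fun y => le_max_right y 0
  have heq : ∀ x : ℝ, 0 ≤ x → ∫ y in (0 : ℝ)..x, f y = ∫ y in (0 : ℝ)..x, f (max y 0) := by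
    intro x hx
    refine intervalIntegral.integral_congr fun y hy => ?_
    rw [Set.uIcc_of_le hx] at hy
    simp only [max_eq_left hy.1]
  have hd : ∀ x, HasDerivAt (fun x => ∫ y in (0 : ℝ)..x, f (max y 0)) (f (max x 0)) x :=
    fun x => hc.integral_hasStrictDerivAt 0 x |>.hasDerivAt
  refine ⟨ContinuousOn.congr (fun x _ => (hd x).continuousAt.continuousWithinAt) heq, ?_⟩
  intro x hx
  have h := hd x
  rw [max_eq_left hx.le] at h
  refine h.congr_of_eventuallyEq ?_
  filter_upwards [Ioi_mem_nhds hx] with y hy using heq y (le_of_lt hy)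

/-- The continuous function on `ℝ` which equals `x ^ ν * I_μ(x)` for `0 ≤ x`. -/
noncomputable def besselWeighted (ν μ x : ℝ) : ℝ :=
  (2⁻¹ : ℝ) ^ μ * (x ^ (ν + μ) * besselEven μ x)

theorem besselWeighted_eq {ν μ x : ℝ} (hν : 0 ≤ ν) (hμ : 0 < μ) (hx : 0 ≤ x) :
    x ^ ν * besselI μ x = besselWeighted ν μ x := by
  rw [besselI_eq_besselEven hμ hx, besselWeighted, Real.rpow_add_of_nonneg hx hν hμ.le,
    div_eq_mul_inv, Real.mul_rpow hx (by norm_num)]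
  ring

theorem continuous_besselWeighted {ν μ : ℝ} (hν : 0 ≤ ν) (hμ : 0 ≤ μ) :
    Continuous (besselWeighted ν μ) :=
  continuous_const.mul ((Real.continuous_rpow_const (by positivity)).mul (continuous_besselEven hμ))

theorem besselWeighted_zero {ν μ : ℝ} (h : 0 < ν + μ) : besselWeighted ν μ 0 = 0 := by
  simp [besselWeighted, Real.zero_rpow h.ne']

theorem hasDerivAt_besselWeighted {ν μ x : ℝ} (hμ : 0 ≤ μ) (hx : 0 < x) :
    HasDerivAt (besselWeighted ν μ)
      ((2⁻¹ : ℝ) ^ μ * x ^ (ν + μ - 1) *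
        ((ν + μ) * besselEven μ x + x * (x / 2 * besselEven (μ + 1) x))) x := by
  refine (((Real.hasDerivAt_rpow_const (p := ν + μ) (Or.inl hx.ne')).mul
    (hasDerivAt_besselEven hμ x)).const_mul _).congr_deriv ?_
  have hr : x ^ (ν + μ) = x ^ (ν + μ - 1) * x := by
    rw [← Real.rpow_add_one hx.ne']
    congr 1
    ring
  rw [hr]
  ring

theorem integral_besselWeighted_le {ν μ x : ℝ} (hν : 1 / 2 ≤ ν) (hμ : 1 / 2 ≤ μ) (hx : 0 ≤ x) :
    ∫ y in (0 : ℝ)..x, besselWeighted ν μ y ≤ besselWeighted ν μ x := by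
  have hc := (continuous_besselWeighted (by linarith : 0 ≤ ν) (by linarith : 0 ≤ μ)).continuousOn
    (s := Set.Ici 0)
  obtain ⟨hFc, hFd⟩ := exists_primitive_of_continuousOn hc
  refine sub_nonneg.1 (nonneg_of_hasDerivAt_nonneg (hc.sub hFc)
    (fun y hy => (hasDerivAt_besselWeighted (by linarith) hy).sub (hFd y hy)) ?_ ?_ hx)
  · intro y hy
    have hr : y ^ (ν + μ) = y ^ (ν + μ - 1) * y := by
      rw [← Real.rpow_add_one hy.ne']
      congr 1
      ring
    have h1 := mul_besselEven_le hμ hy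
    have h2 := besselEven_pos (by linarith : 0 ≤ μ) y
    have h3 : 0 < (2⁻¹ : ℝ) ^ μ * y ^ (ν + μ - 1) := by positivity
    have h4 : 0 ≤ (ν + μ) * besselEven μ y + y * (y / 2 * besselEven (μ + 1) y) -
      y * besselEven μ y := by nlinarith
    rw [besselWeighted, hr]
    calc 0 ≤ _ := mul_nonneg h3.le h4
      _ = _ := by ring
  · simp [besselWeighted_zero (by linarith : 0 < ν + μ)]

theorem integral_exp_mul_besselWeighted_le {ν μ γ x : ℝ} (hν : 1 / 2 ≤ ν) (hμ : 1 / 2 ≤ μ)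
    (hγ0 : 0 ≤ γ) (hγ1 : γ < 1) (hx : 0 ≤ x) :
    ∫ y in (0 : ℝ)..x, Real.exp (-γ * y) * besselWeighted ν μ y ≤
      1 / (1 - γ) * (Real.exp (-γ * x) * ∫ y in (0 : ℝ)..x, besselWeighted ν μ y) := by
  have hc := continuous_besselWeighted (by linarith : 0 ≤ ν) (by linarith : 0 ≤ μ)
  obtain ⟨hFc, hFd⟩ := exists_primitive_of_continuousOn (hc.continuousOn (s := Set.Ici 0))
  have hec : Continuous fun y => Real.exp (-γ * y) := by fun_prop
  obtain ⟨hJc, hJd⟩ := exists_primitive_of_continuousOn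
    (f := fun y => Real.exp (-γ * y) * besselWeighted ν μ y) (hec.mul hc).continuousOn
  have hed : ∀ y, HasDerivAt (fun y => Real.exp (-γ * y)) (Real.exp (-γ * y) * (-γ * 1)) y :=
    fun y => ((hasDerivAt_id y).const_mul (-γ)).exp
  have h1γ : 0 < 1 - γ := by linarith
  refine sub_nonneg.1 (nonneg_of_hasDerivAt_nonneg
    ((continuousOn_const.mul (hec.continuousOn.mul hFc)).sub hJc)
    (fun y hy => (((hed y).mul (hFd y hy)).const_mul (1 / (1 - γ))).sub (hJd y hy)) ?_ ?_ hx)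
  · intro y hy
    have h1 := sub_nonneg.2 (integral_besselWeighted_le hν hμ hy.le)
    calc 0 ≤ 1 / (1 - γ) * Real.exp (-γ * y) * γ *
          (besselWeighted ν μ y - ∫ z in (0 : ℝ)..y, besselWeighted ν μ z) := by positivity
      _ = _ := by
        field_simp
        ring
  · simp

theorem integral_besselWeighted_lt {ν m x : ℝ} (hν : 1 / 2 ≤ ν) (hm : 0 ≤ m) (hx : 0 < x) :
    ∫ y in (0 : ℝ)..x, besselWeighted ν (ν + m) y <
      (2 * ν + 2 * (m + 1)) / (2 * ν + (m + 1)) * besselWeighted ν (ν + m + 1) x := by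
  have hν0 : 0 ≤ ν := by linarith
  have hc := continuous_besselWeighted hν0 (by linarith : 0 ≤ ν + m)
  have hc1 := continuous_besselWeighted hν0 (by linarith : 0 ≤ ν + m + 1)
  obtain ⟨hFc, hFd⟩ := exists_primitive_of_continuousOn (hc.continuousOn (s := Set.Ici 0))
  refine sub_pos.1 (pos_of_hasDerivAt_pos
    ((continuousOn_const.mul hc1.continuousOn).sub hFc)
    (fun y hy => ((hasDerivAt_besselWeighted (by linarith) hy).const_mul _).sub (hFd y hy)) ?_ ?_ hx)
  · intro y hy
    have hrec := besselEven_recurrence (by linarith : 0 ≤ ν + m) y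
    have h2 := besselEven_pos (by linarith : 0 ≤ ν + m + 2) y
    have hD : 0 < 2 * ν + (m + 1) := by linarith
    have h3 : (2⁻¹ : ℝ) ^ (ν + m + 1) = (2⁻¹ : ℝ) ^ (ν + m) * 2⁻¹ :=
      Real.rpow_add_one (by norm_num) _
    rw [besselWeighted, hrec, h3, show ν + (ν + m + 1) - 1 = ν + (ν + m) by ring,
      show ν + m + 1 + 1 = ν + m + 2 by ring]
    calc 0 < (2⁻¹ : ℝ) ^ (ν + m) * y ^ (ν + (ν + m)) * ((m + 1) / (2 * ν + (m + 1)) *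
          (y ^ 2 / 4 * besselEven (ν + m + 2) y)) := by positivity
      _ = _ := by
        field_simp
        ring
  · simp [besselWeighted_zero (by linarith : 0 < ν + (ν + m + 1))]

theorem integral_exp_mul_besselWeighted_lt {ν m γ x : ℝ} (hν : 1 / 2 ≤ ν) (hm : 0 ≤ m)
    (hγ0 : 0 ≤ γ) (hγ1 : γ < 1) (hx : 0 < x) :
    ∫ y in (0 : ℝ)..x, Real.exp (-γ * y) * besselWeighted ν (ν + m) y <
      1 / (1 - γ) * (Real.exp (-γ * x) *
        ((2 * ν + 2 * (m + 1)) / (2 * ν + (m + 1)) * besselWeighted ν (ν + m + 1) x)) := by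
  have h1γ : 0 < 1 - γ := by linarith
  refine (integral_exp_mul_besselWeighted_le hν (by linarith) hγ0 hγ1 hx.le).trans_lt ?_
  have := integral_besselWeighted_lt hν hm hx
  gcongr

theorem continuousOn_besselIRep {ν : ℝ} (hν : 0 < ν) (β : ℝ) (n : ℕ) :
    ContinuousOn (besselIRep ν β n) (Set.Ici 0) := by
  induction n with
  | zero =>
    have hc : Continuous fun x => Real.exp (β * x) * besselWeighted ν ν x :=
      (by fun_prop : Continuous fun x => Real.exp (β * x)).mul
        (continuous_besselWeighted hν.le hν.le)
    refine hc.continuousOn.congr fun x hx => ?_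
    simp only [besselIRep]
    rw [mul_assoc, besselWeighted_eq hν.le hν hx]
  | succ n ih => exact (exists_primitive_of_continuousOn ih).1

/-- The constant `(1-γ)^{-n} ∏_{k=1}^n (2ν+2k)/(2ν+k)`. -/
noncomputable def besselIRepConst (ν γ : ℝ) (n : ℕ) : ℝ :=
  (1 / (1 - γ) ^ n) * ∏ k ∈ Finset.Icc 1 n, (2 * ν + 2 * (k : ℝ)) / (2 * ν + (k : ℝ))

theorem besselIRepConst_pos {ν γ : ℝ} (hν : 0 < ν) (hγ : γ < 1) (n : ℕ) :
    0 < besselIRepConst ν γ n := by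
  have : 0 < 1 - γ := by linarith
  exact mul_pos (by positivity) (Finset.prod_pos fun k _ => by positivity)

theorem besselIRepConst_succ (ν γ : ℝ) (n : ℕ) :
    besselIRepConst ν γ (n + 1) = besselIRepConst ν γ n *
      (1 / (1 - γ) * ((2 * ν + 2 * ((n : ℝ) + 1)) / (2 * ν + ((n : ℝ) + 1)))) := by
  rw [besselIRepConst, besselIRepConst, Finset.prod_Icc_succ_top (by omega), pow_succ,
    one_div_mul_eq_div, one_div_mul_eq_div, ← div_div]
  push_cast
  ring

theorem besselIRep_succ_lt_of_le {ν γ : ℝ} (hν : 1 / 2 ≤ ν) (hγ0 : 0 ≤ γ) (hγ1 : γ < 1) (n : ℕ)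
    (h : ∀ y, 0 ≤ y → besselIRep ν (-γ) n y ≤
      besselIRepConst ν γ n * (Real.exp (-γ * y) * besselWeighted ν (ν + n) y))
    {x : ℝ} (hx : 0 < x) :
    besselIRep ν (-γ) (n + 1) x < besselIRepConst ν γ (n + 1) *
      (Real.exp (-γ * x) * besselWeighted ν (ν + (n + 1 : ℕ)) x) := by
  have hν0 : 0 < ν := by linarith
  have hn : (0 : ℝ) ≤ n := n.cast_nonneg
  have hc : Continuous fun y => besselIRepConst ν γ n *
      (Real.exp (-γ * y) * besselWeighted ν (ν + n) y) :=
    continuous_const.mul ((by fun_prop : Continuous fun y => Real.exp (-γ * y)).mul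
      (continuous_besselWeighted hν0.le (by positivity)))
  have hint : IntervalIntegrable (besselIRep ν (-γ) n) volume 0 x :=
    ((continuousOn_besselIRep hν0 (-γ) n).mono (by
      rw [Set.uIcc_of_le hx.le]
      exact Set.Icc_subset_Ici_self)).intervalIntegrable
  calc besselIRep ν (-γ) (n + 1) x = ∫ y in (0 : ℝ)..x, besselIRep ν (-γ) n y := rfl
    _ ≤ ∫ y in (0 : ℝ)..x, besselIRepConst ν γ n *
          (Real.exp (-γ * y) * besselWeighted ν (ν + n) y) :=
      intervalIntegral.integral_mono_on hx.le hint (hc.intervalIntegrable 0 x)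
        fun y hy => h y hy.1
    _ = besselIRepConst ν γ n *
          ∫ y in (0 : ℝ)..x, Real.exp (-γ * y) * besselWeighted ν (ν + n) y :=
      intervalIntegral.integral_const_mul _ _
    _ < besselIRepConst ν γ n * (1 / (1 - γ) * (Real.exp (-γ * x) *
          ((2 * ν + 2 * ((n : ℝ) + 1)) / (2 * ν + ((n : ℝ) + 1)) *
            besselWeighted ν (ν + n + 1) x))) :=
      mul_lt_mul_of_pos_left (integral_exp_mul_besselWeighted_lt hν hn hγ0 hγ1 hx)
        (besselIRepConst_pos hν0 hγ1 n)
    _ = _ := by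
      rw [besselIRepConst_succ, Nat.cast_succ, ← add_assoc ν]
      ring

theorem besselIRep_le {ν γ : ℝ} (hν : 1 / 2 ≤ ν) (hγ0 : 0 ≤ γ) (hγ1 : γ < 1) (n : ℕ)
    {x : ℝ} (hx : 0 ≤ x) :
    besselIRep ν (-γ) n x ≤
      besselIRepConst ν γ n * (Real.exp (-γ * x) * besselWeighted ν (ν + n) x) := by
  have hν0 : 0 < ν := by linarith
  induction n generalizing x with
  | zero =>
    simp only [besselIRep, besselIRepConst]
    rw [mul_assoc, besselWeighted_eq hν0.le hν0 hx]
    simp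
  | succ n ih =>
    rcases hx.eq_or_lt with rfl | hx
    · have : 0 < ν + (ν + ((n + 1 : ℕ) : ℝ)) := by positivity
      simp only [besselIRep, intervalIntegral.integral_same, besselWeighted_zero this, mul_zero,
        le_refl]
    · exact (besselIRep_succ_lt_of_le hν hγ0 hγ1 n (fun y hy => ih hy) hx).le

theorem besselIRep_neg_gamma_upper_bound (ν γ : ℝ) (hν : 1 / 2 ≤ ν) (hγ0 : 0 ≤ γ)
    (hγ1 : γ < 1) (n : ℕ) (hn : 1 ≤ n) (x : ℝ) (hx : 0 < x) :
    besselIRep ν (-γ) n x <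
      (1 / (1 - γ) ^ n) * (∏ k ∈ Finset.Icc 1 n, (2 * ν + 2 * (k : ℝ)) / (2 * ν + (k : ℝ))) *
        Real.exp (-γ * x) * x ^ ν * besselI (ν + n) x := by
  obtain ⟨n, rfl⟩ := Nat.exists_eq_succ_of_ne_zero (Nat.one_le_iff_ne_zero.1 hn)
  have hν0 : 0 < ν := by linarith
  have h := besselIRep_succ_lt_of_le hν hγ0 hγ1 n (fun y hy => besselIRep_le hν hγ0 hγ1 n hy) hx
  rw [← besselWeighted_eq hν0.le (by positivity) hx.le, ← mul_assoc, ← mul_assoc] at h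
  exact h
end
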